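/- Parseval's identity for Kummer's series: ∫₀¹ (log(Γ(α)/√(2π)))² dα = Σ_{n≥1} (1/(2n²)) ( ((log(2πn)+γ)²/π²) + 1/4 ). -/

import Mathlib

open Complex Real
open MeasureTheory Filter Topology

/-- The function `1/x - (π/2) cot (πx/2)`, which has a removable singularity at `0`. -/
noncomputable def cotRemainder (x : ℝ) : ℝ :=
  1 / x - π / 2 * (Real.cos (π / 2 * x) / Real.sin (π / 2 * x))

lemma half_pi_mul_mem {x : ℝ} (hx : x ∈ Set.Ioo (0 : ℝ) 1) :
    0 < π / 2 * x ∧ π / 2 * x < π / 2 := by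
  have := Real.pi_pos
  exact ⟨by have := hx.1; positivity, by nlinarith [hx.2]⟩

lemma sin_half_pi_mul_pos {x : ℝ} (hx : x ∈ Set.Ioo (0 : ℝ) 1) : 0 < Real.sin (π / 2 * x) := by
  have h := half_pi_mul_mem hx
  exact Real.sin_pos_of_pos_of_lt_pi h.1 (by linarith [Real.pi_pos])

lemma cotRemainder_nonneg {x : ℝ} (hx : x ∈ Set.Ioo (0 : ℝ) 1) : 0 ≤ cotRemainder x := by
  have h := half_pi_mul_mem hx
  have hs := sin_half_pi_mul_pos hx
  have hc : 0 < Real.cos (π / 2 * x) := Real.cos_pos_of_mem_Ioo ⟨by linarith, h.2⟩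
  have ht := Real.lt_tan h.1 h.2
  rw [Real.tan_eq_sin_div_cos, lt_div_iff₀ hc] at ht
  have hx0 := hx.1
  rw [cotRemainder, sub_nonneg, ← mul_div_assoc, div_le_div_iff₀ hs hx0]
  linarith

lemma continuousOn_log_sinc :
    ContinuousOn (fun x : ℝ => -Real.log (π / 2 * Real.sinc (π / 2 * x))) (Set.Icc 0 1) := by
  refine ContinuousOn.neg (ContinuousOn.log ?_ ?_)
  · have := Real.continuous_sinc
    fun_prop
  · intro x hx
    have hpi := Real.pi_pos
    rcases hx.1.eq_or_lt with rfl | h0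
    · simp [hpi.ne']
    · have h1 : 0 < π / 2 * x := by positivity
      rw [Real.sinc_of_ne_zero h1.ne']
      have : 0 < Real.sin (π / 2 * x) :=
        Real.sin_pos_of_pos_of_lt_pi h1 (by nlinarith [hx.2])
      positivity

lemma hasDerivAt_log_sinc {x : ℝ} (hx : x ∈ Set.Ioo (0 : ℝ) 1) :
    HasDerivAt (fun x : ℝ => -Real.log (π / 2 * Real.sinc (π / 2 * x))) (cotRemainder x) x := by
  have hs := sin_half_pi_mul_pos hx
  have hx0 := hx.1
  have hd : HasDerivAt (fun x : ℝ => Real.log x - Real.log (Real.sin (π / 2 * x)))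
      (cotRemainder x) x := by
    have h1 := Real.hasDerivAt_log hx0.ne'
    have h2 := ((hasDerivAt_id x).const_mul (π / 2)).sin.log hs.ne'
    refine (h1.sub h2).congr_deriv ?_
    simp only [cotRemainder, id, mul_one, one_div]
    ring
  refine hd.congr_of_eventuallyEq ?_
  filter_upwards [isOpen_Ioo.mem_nhds hx] with y hy
  have hy0 := hy.1
  have h1 := half_pi_mul_mem hy
  have hs := sin_half_pi_mul_pos hy
  have hpi := Real.pi_pos
  rw [Real.sinc_of_ne_zero h1.1.ne', ← Real.log_div hy0.ne' hs.ne', ← Real.log_inv]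
  congr 1
  field_simp

lemma intervalIntegrable_cotRemainder : IntervalIntegrable cotRemainder volume 0 1 := by
  rw [intervalIntegrable_iff_integrableOn_Ioc_of_le zero_le_one]
  exact intervalIntegral.integrableOn_deriv_of_nonneg continuousOn_log_sinc
    (fun x hx => hasDerivAt_log_sinc hx) (fun x hx => cotRemainder_nonneg hx)

lemma IntervalIntegrable.complex_ofReal {f : ℝ → ℝ} {a b : ℝ}
    (hf : IntervalIntegrable f volume a b) :
    IntervalIntegrable (fun x => (f x : ℂ)) volume a b :=
  ⟨hf.1.ofReal, hf.2.ofReal⟩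

lemma integral_cotRemainder : ∫ x in (0:ℝ)..1, cotRemainder x = Real.log (π / 2) := by
  rw [intervalIntegral.integral_eq_sub_of_hasDerivAt_of_le zero_le_one continuousOn_log_sinc
    (fun x hx => hasDerivAt_log_sinc hx) intervalIntegrable_cotRemainder]
  have : π / 2 ≠ 0 := by positivity
  simp [Real.sinc_of_ne_zero this]

lemma tendsto_integral_cotRemainder_mul_exp :
    Tendsto (fun N : ℕ => ∫ x in (0:ℝ)..1, (cotRemainder x : ℂ) * cexp (-(2 * π * I * N * x)))
      atTop (𝓝 0) := by
  have h := Real.tendsto_integral_exp_smul_cocompact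
    (Set.indicator (Set.Ioc 0 1) fun x : ℝ => (cotRemainder x : ℂ))
  have hN : Tendsto (fun N : ℕ => (N : ℝ)) atTop (cocompact ℝ) :=
    tendsto_natCast_atTop_atTop.mono_right atTop_le_cocompact
  refine (h.comp hN).congr fun N => ?_
  simp only [Function.comp_apply]
  rw [intervalIntegral.integral_of_le zero_le_one, ← integral_indicator measurableSet_Ioc]
  congr 1 with x
  by_cases hx : x ∈ Set.Ioc (0 : ℝ) 1
  · simp only [Set.indicator_of_mem hx, Circle.smul_def, Real.fourierChar_apply, smul_eq_mul]
    rw [mul_comm]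
    congr 2
    push_cast
    ring
  · simp [Set.indicator_of_notMem hx]

lemma integral_exp_pi_mul (k : ℕ) (hk : k ≠ 0) :
    ∫ x in (0:ℝ)..1, cexp (-(π * I * k * x)) = (1 - (-1) ^ k) / (π * I * k) := by
  have hc : -(π * I * k : ℂ) ≠ 0 := by simp [hk, Real.pi_ne_zero]
  have := integral_exp_mul_complex (a := 0) (b := 1) hc
  simp only [neg_mul] at this
  rw [this]
  have h1 : cexp (-(π * I * k * (1 : ℝ))) = (-1) ^ k := by
    rw [← Complex.exp_pi_mul_I, ← Complex.exp_nat_mul, Complex.exp_eq_exp_iff_exists_int]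
    exact ⟨-k, by push_cast; ring⟩
  rw [h1, div_neg, ← neg_div]
  simp

lemma one_sub_exp_mul_cot (N : ℕ) {x : ℝ} (hx : x ∈ Set.Ioo (0 : ℝ) 1) :
    (1 - cexp (-(2 * π * I * N * x))) *
      ((π / 2 * (Real.cos (π / 2 * x) / Real.sin (π / 2 * x)) : ℝ) : ℂ) =
    ∑ k ∈ Finset.range (2 * N), I * π / 2 *
      (cexp (-(π * I * k * x)) + cexp (-(π * I * (k + 1 : ℕ) * x))) := by
  set w := cexp (-(π * I * x)) with hw
  have hk (k : ℕ) : cexp (-(π * I * k * x)) = w ^ k := by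
    rw [hw, ← Complex.exp_nat_mul]; congr 1; ring
  have hN : cexp (-(2 * π * I * N * x)) = w ^ (2 * N) := by
    rw [← hk]; congr 1; push_cast; ring
  have hs : Complex.sin (π / 2 * x) ≠ 0 := by
    have := (sin_half_pi_mul_pos hx).ne'
    exact_mod_cast this
  set v := cexp (-(π / 2 * x) * I) with hv
  have hwv : w = v * v := by rw [hw, hv, ← Complex.exp_add]; congr 1; ring
  have hv' : cexp ((π / 2 * x) * I) * v = 1 := by
    rw [hv, ← Complex.exp_add]; simp
  have hsin : 1 - w = 2 * I * Complex.sin (π / 2 * x) * v := by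
    rw [Complex.sin, ← hv, hwv]
    linear_combination (-v * v + cexp ((π / 2 * x) * I) * v) * Complex.I_sq - hv'
  have hcos : 1 + w = 2 * Complex.cos (π / 2 * x) * v := by
    rw [Complex.cos, ← hv, hwv]
    linear_combination -hv'
  simp_rw [hk, hN, pow_succ, ← mul_one_add, ← mul_assoc, ← Finset.sum_mul, ← Finset.mul_sum]
  have hg := mul_neg_geom_sum w (2 * N)
  rw [← hg, hsin, hcos]
  push_cast
  generalize Complex.sin (π / 2 * x) = S at *
  field_simp

lemma integral_one_sub_exp_mul_cot (N : ℕ) :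
    ∫ x in (0:ℝ)..1, (1 - cexp (-(2 * π * I * (N + 1 : ℕ) * x))) *
      ((π / 2 * (Real.cos (π / 2 * x) / Real.sin (π / 2 * x)) : ℝ) : ℂ) =
    I * π / 2 + (2 * harmonic (2 * (N + 1)) - harmonic (N + 1) : ℚ) := by
  have hI (k : ℕ) : IntervalIntegrable (fun x : ℝ => cexp (-(π * I * k * x))) volume 0 1 :=
    Continuous.intervalIntegrable (by fun_prop) _ _
  have h1 (M : ℕ) : ∫ x in (0:ℝ)..1, (1 - cexp (-(2 * π * I * M * x))) *
      ((π / 2 * (Real.cos (π / 2 * x) / Real.sin (π / 2 * x)) : ℝ) : ℂ) =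
      ∑ k ∈ Finset.range (2 * M), I * π / 2 * ((∫ x in (0:ℝ)..1, cexp (-(π * I * k * x))) +
        ∫ x in (0:ℝ)..1, cexp (-(π * I * (k + 1 : ℕ) * x))) := by
    rw [intervalIntegral.integral_congr_Ioo_of_le zero_le_one
      (g := fun x : ℝ => ∑ k ∈ Finset.range (2 * M),
      I * π / 2 * (cexp (-(π * I * k * x)) + cexp (-(π * I * (k + 1 : ℕ) * x))))
      (fun x hx => one_sub_exp_mul_cot M hx),
      intervalIntegral.integral_finsetSum]
    · refine Finset.sum_congr rfl fun k _ => ?_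
      rw [intervalIntegral.integral_const_mul, intervalIntegral.integral_add (hI k) (hI (k + 1))]
    · intro k _
      exact ((hI k).add (hI (k + 1))).const_mul _
  rw [h1]
  have hpi : (π : ℂ) ≠ 0 := by exact_mod_cast Real.pi_ne_zero
  induction N with
  | zero =>
    have h1 := integral_exp_pi_mul 1 one_ne_zero
    have h2 := integral_exp_pi_mul 2 two_ne_zero
    norm_num [Finset.sum_range_succ, harmonic] at h1 h2 ⊢
    rw [h1, h2]
    field_simp
    ring
  | succ N ih =>
    have e : 2 * (N + 1 + 1) = 2 * (N + 1) + 1 + 1 := by ring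
    rw [e, Finset.sum_range_succ, Finset.sum_range_succ, ih, harmonic_succ (N + 1),
      harmonic_succ (2 * (N + 1) + 1), harmonic_succ (2 * (N + 1)),
      integral_exp_pi_mul _ (by omega), integral_exp_pi_mul _ (by omega),
      integral_exp_pi_mul _ (by omega)]
    have h2 : (-1 : ℂ) ^ (2 * (N + 1)) = 1 := by rw [pow_mul]; simp
    simp only [pow_succ _ (2 * (N + 1)), pow_succ _ (2 * (N + 1) + 1), h2]
    have a1 : (2 * (N + 1) + 1 : ℂ) ≠ 0 := by exact_mod_cast (by omega : 2 * (N + 1) + 1 ≠ 0)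
    have a2 : (N + 1 + 1 : ℂ) ≠ 0 := by exact_mod_cast (by omega : N + 1 + 1 ≠ 0)
    have a3 : (2 * (N + 1) + 1 + 1 : ℂ) ≠ 0 := by
      exact_mod_cast (by omega : 2 * (N + 1) + 1 + 1 ≠ 0)
    generalize harmonic (2 * (N + 1)) = H
    generalize harmonic (N + 1) = H'
    push_cast
    field_simp
    ring

/-- The logarithmic asymptotics of `∫₀¹ (1 - exp (-2πiNx)) / x dx`. -/
lemma tendsto_integral_one_sub_exp_div :
    Tendsto (fun N : ℕ => (∫ x in (0:ℝ)..1, (1 - cexp (-(2 * π * I * N * x))) / x) - Real.log N)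
      atTop (𝓝 (Real.log (2 * π) + Real.eulerMascheroniConstant + I * π / 2)) := by
  have hh : Tendsto (fun N : ℕ => (2 * harmonic (2 * N) - harmonic N : ℝ) - Real.log N) atTop
      (𝓝 (2 * Real.log 2 + Real.eulerMascheroniConstant)) := by
    have h1 := Real.tendsto_harmonic_sub_log
    have h2 : Tendsto (fun n : ℕ => 2 * n) atTop atTop :=
      tendsto_id.const_mul_atTop' two_pos
    have h3 := (((h1.comp h2).const_mul 2).sub h1).add_const (2 * Real.log 2)
    convert h3.congr' ?_ using 2
    · ring
    · filter_upwards [eventually_ne_atTop 0] with n hn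
      have : (n : ℝ) ≠ 0 := by exact_mod_cast hn
      simp only [Function.comp_apply, Nat.cast_mul, Nat.cast_ofNat]
      rw [Real.log_mul two_ne_zero this]
      ring
  have hlim := ((Complex.continuous_ofReal.tendsto _).comp hh).add_const
    (I * π / 2 + Real.log (π / 2)) |>.sub tendsto_integral_cotRemainder_mul_exp
  have hval : ((2 * Real.log 2 + Real.eulerMascheroniConstant : ℝ) : ℂ) +
      (I * π / 2 + Real.log (π / 2)) - 0 =
      Real.log (2 * π) + Real.eulerMascheroniConstant + I * π / 2 := by
    rw [Real.log_div Real.pi_ne_zero two_ne_zero, Real.log_mul two_ne_zero Real.pi_ne_zero]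
    push_cast
    ring
  rw [hval] at hlim
  refine hlim.congr' ?_
  filter_upwards [eventually_ne_atTop 0] with N hN
  obtain ⟨N, rfl⟩ := Nat.exists_eq_succ_of_ne_zero hN
  simp only [Nat.succ_eq_add_one, Function.comp_apply]
  have hr : IntervalIntegrable (fun x => (cotRemainder x : ℂ)) volume 0 1 :=
    intervalIntegrable_cotRemainder.complex_ofReal
  have hre : IntervalIntegrable (fun x : ℝ => (cotRemainder x : ℂ) *
      cexp (-(2 * π * I * (N + 1 : ℕ) * x))) volume 0 1 :=
    hr.mul_continuousOn (by fun_prop)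
  have hc : IntervalIntegrable (fun x : ℝ => (1 - cexp (-(2 * π * I * (N + 1 : ℕ) * x))) *
      ((π / 2 * (Real.cos (π / 2 * x) / Real.sin (π / 2 * x)) : ℝ) : ℂ)) volume 0 1 := by
    refine (Continuous.intervalIntegrable (u := fun x : ℝ =>
      ∑ k ∈ Finset.range (2 * (N + 1)), I * π / 2 *
      (cexp (-(π * I * k * x)) + cexp (-(π * I * (k + 1 : ℕ) * x))))
      (by fun_prop) 0 1).congr_uIoo ?_
    rw [Set.uIoo_of_le zero_le_one]
    exact fun x hx => (one_sub_exp_mul_cot (N + 1) hx).symm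
  have hsplit : ∫ x in (0:ℝ)..1, (1 - cexp (-(2 * π * I * (N + 1 : ℕ) * x))) / x =
      ∫ x in (0:ℝ)..1, ((1 - cexp (-(2 * π * I * (N + 1 : ℕ) * x))) *
        ((π / 2 * (Real.cos (π / 2 * x) / Real.sin (π / 2 * x)) : ℝ) : ℂ) +
        (cotRemainder x - (cotRemainder x : ℂ) * cexp (-(2 * π * I * (N + 1 : ℕ) * x)))) := by
    refine intervalIntegral.integral_congr fun x _ => ?_
    simp only [cotRemainder]
    push_cast
    ring
  rw [hsplit, intervalIntegral.integral_add hc (hr.sub hre), intervalIntegral.integral_sub hr hre,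
    integral_one_sub_exp_mul_cot, intervalIntegral.integral_ofReal, integral_cotRemainder]
  push_cast
  ring

lemma exp_neg_two_pi_mul_nat (n M : ℕ) : cexp (-(2 * π * I * n * M)) = 1 := by
  rw [Complex.exp_eq_one_iff]
  exact ⟨-(n * M), by push_cast; ring⟩

lemma hasDerivAt_exp_two_pi (n : ℕ) (x : ℝ) :
    HasDerivAt (fun x : ℝ => cexp (-(2 * π * I * n * x)))
      (-(2 * π * I * n) * cexp (-(2 * π * I * n * x))) x := by
  have h := ((Complex.ofRealCLM.hasDerivAt (x := x)).const_mul (2 * π * I * n)).neg.cexp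
  simpa [mul_comm] using h

lemma exists_continuous_one_sub_exp_eq_mul (n : ℕ) :
    ∃ g : ℝ → ℂ, Continuous g ∧ ∀ x : ℝ, 1 - cexp (-(2 * π * I * n * x)) = x * g x := by
  refine ⟨dslope (fun x : ℝ => 1 - cexp (-(2 * π * I * n * x))) 0, ?_, fun x => ?_⟩
  · rw [← continuousOn_univ, continuousOn_dslope univ_mem]
    exact ⟨by fun_prop, ((hasDerivAt_exp_two_pi n 0).const_sub 1).differentiableAt⟩
  · have := sub_smul_dslope (fun x : ℝ => 1 - cexp (-(2 * π * I * n * x))) 0 x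
    simp only [sub_zero, Complex.real_smul] at this
    rw [this]
    simp

/-- Integration by parts for the Fourier integral of the logarithm over an integer interval. -/
lemma integral_log_mul_exp {n M : ℕ} (hn : n ≠ 0) (hM : M ≠ 0) :
    ∫ x in (0:ℝ)..M, (Real.log x : ℂ) * cexp (-(2 * π * I * n * x)) =
      -(1 / (2 * π * I * n)) *
        ∫ x in (0:ℝ)..1, (1 - cexp (-(2 * π * I * (n * M : ℕ) * x))) / x := by
  obtain ⟨g, hg, hgx⟩ := exists_continuous_one_sub_exp_eq_mul n
  have hc : (2 * π * I * n : ℂ) ≠ 0 := by simp [hn, Real.pi_ne_zero]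
  have hM0 : (0 : ℝ) ≤ M := Nat.cast_nonneg M
  have hlog : IntervalIntegrable (fun x : ℝ => (Real.log x : ℂ) * cexp (-(2 * π * I * n * x)))
      volume 0 M :=
    intervalIntegral.intervalIntegrable_log'.complex_ofReal.mul_continuousOn (by fun_prop)
  have hgi : IntervalIntegrable g volume 0 M := hg.intervalIntegrable _ _
  have hcont : ContinuousOn (fun x : ℝ => (Real.log x : ℂ) * (1 - cexp (-(2 * π * I * n * x))))
      (Set.Icc 0 M) := by
    have : (fun x : ℝ => (Real.log x : ℂ) * (1 - cexp (-(2 * π * I * n * x)))) =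
        fun x : ℝ => ((x * Real.log x : ℝ) : ℂ) * g x := by
      ext x
      rw [hgx]
      push_cast
      ring
    rw [this]
    have := Real.continuous_mul_log
    fun_prop
  have hderiv (x : ℝ) (hx : x ∈ Set.Ioo (0 : ℝ) M) :
      HasDerivAt (fun x : ℝ => (Real.log x : ℂ) * (1 - cexp (-(2 * π * I * n * x))))
        (g x + 2 * π * I * n * (Real.log x * cexp (-(2 * π * I * n * x)))) x := by
    have h1 := (Real.hasDerivAt_log hx.1.ne').ofReal_comp
    refine (h1.mul ((hasDerivAt_exp_two_pi n x).const_sub 1)).congr_deriv ?_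
    have hx0 : (x : ℂ) ≠ 0 := by exact_mod_cast hx.1.ne'
    rw [hgx]
    push_cast
    field_simp
  have hint := intervalIntegral.integral_eq_sub_of_hasDerivAt_of_le hM0 hcont hderiv
    (hgi.add (hlog.const_mul _))
  rw [intervalIntegral.integral_add hgi (hlog.const_mul _),
    intervalIntegral.integral_const_mul] at hint
  simp only [Complex.ofReal_natCast, exp_neg_two_pi_mul_nat, sub_self, mul_zero,
    Complex.ofReal_zero, neg_zero, Complex.exp_zero] at hint
  have hgM : ∫ x in (0:ℝ)..M, g x =
      ∫ x in (0:ℝ)..1, (1 - cexp (-(2 * π * I * (n * M : ℕ) * x))) / x := by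
    have hM' : (M : ℝ) ≠ 0 := by exact_mod_cast hM
    have hs := intervalIntegral.smul_integral_comp_mul_left (a := 0) (b := 1) g (M : ℝ)
    rw [mul_zero, mul_one] at hs
    rw [← hs, ← intervalIntegral.integral_smul]
    refine intervalIntegral.integral_congr_Ioo_of_le zero_le_one fun x hx => ?_
    have hx0 : (x : ℂ) ≠ 0 := by
      have : 0 < x := hx.1
      exact_mod_cast this.ne'
    have h2 := hgx (M * x)
    push_cast at h2 ⊢
    rw [Complex.real_smul, eq_div_iff hx0, Complex.ofReal_natCast]
    calc (M : ℂ) * g (M * x) * x = M * x * g (M * x) := by ring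
      _ = 1 - cexp (-(2 * π * I * n * (M * x))) := h2.symm
      _ = _ := by rw [← mul_assoc, ← mul_assoc]
  rw [← hgM]
  field_simp
  linear_combination hint

lemma abs_log_Gamma_sub_logGammaSeq_le {x : ℝ} (hx : x ∈ Set.Ioc (0 : ℝ) 1) {m : ℕ} (hm : m ≠ 0) :
    |Real.log (Real.Gamma x) - BohrMollerup.logGammaSeq x m| ≤ Real.log (m + 1) - Real.log m := by
  have hf {y : ℝ} (hy : 0 < y) :
      (Real.log ∘ Real.Gamma) (y + 1) = (Real.log ∘ Real.Gamma) y + Real.log y := by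
    simp only [Function.comp_apply]
    rw [Real.Gamma_add_one hy.ne', Real.log_mul hy.ne' (Real.Gamma_pos_of_pos hy).ne', add_comm]
  have h1 := BohrMollerup.le_logGammaSeq convexOn_log_Gamma hf hx.1 hx.2 m
  have h2 := BohrMollerup.ge_logGammaSeq convexOn_log_Gamma hf hx.1 hm
  simp only [Function.comp_apply, Real.Gamma_one, Real.log_one] at h1 h2
  have h3 : 0 ≤ Real.log (m + 1) - Real.log m := by
    have : (0 : ℝ) < m := by exact_mod_cast Nat.pos_of_ne_zero hm
    exact sub_nonneg.2 (Real.log_le_log this (by linarith))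
  rw [abs_le]
  constructor
  · linarith
  · nlinarith [hx.2]

lemma memLp_log : MemLp Real.log 2 (volume.restrict (Set.Ioc (0 : ℝ) 1)) := by
  rw [memLp_two_iff_integrable_sq Real.measurable_log.aestronglyMeasurable]
  have hi : IntegrableOn (fun x : ℝ => 16 * x ^ (-(1 / 2) : ℝ)) (Set.Ioc 0 1) := by
    rw [← intervalIntegrable_iff_integrableOn_Ioc_of_le zero_le_one]
    exact (intervalIntegral.intervalIntegrable_rpow' (by norm_num)).const_mul _
  refine Integrable.mono' hi (Real.measurable_log.pow_const 2).aestronglyMeasurable ?_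
  filter_upwards [ae_restrict_mem measurableSet_Ioc] with x hx
  have h := Real.abs_log_mul_self_rpow_lt x (1 / 4) hx.1 hx.2 (by norm_num)
  have hp : 0 < x ^ (1 / 4 : ℝ) := Real.rpow_pos_of_pos hx.1 _
  have hpow : (x ^ (1 / 4 : ℝ)) ^ 2 = x ^ (1 / 2 : ℝ) := by
    rw [← Real.rpow_natCast, ← Real.rpow_mul hx.1.le]
    norm_num
  have hq : 0 < x ^ (1 / 2 : ℝ) := Real.rpow_pos_of_pos hx.1 _
  rw [Real.norm_eq_abs, abs_of_nonneg (sq_nonneg _), Real.rpow_neg hx.1.le, ← div_eq_mul_inv,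
    le_div_iff₀ hq, ← hpow, ← mul_pow, ← sq_abs]
  rw [one_div_one_div] at h
  nlinarith [abs_nonneg (Real.log x * x ^ (1 / 4 : ℝ))]

lemma memLp_log_Gamma :
    MemLp (fun x => Real.log (Real.Gamma x)) 2 (volume.restrict (Set.Ioc (0 : ℝ) 1)) := by
  have hc : ContinuousOn (fun x : ℝ => Real.log (Real.Gamma (x + 1))) (Set.Icc 0 1) := by
    refine ContinuousOn.log ?_ ?_
    · exact differentiableOn_Gamma_Ioi.continuousOn.comp (by fun_prop)
        fun x hx => by simpa using (by linarith [hx.1] : 0 < x + 1)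
    · exact fun x hx => (Real.Gamma_pos_of_pos (by linarith [hx.1])).ne'
  have h1 : MemLp (fun x : ℝ => Real.log (Real.Gamma (x + 1))) 2
      (volume.restrict (Set.Ioc (0 : ℝ) 1)) := by
    obtain ⟨C, hC⟩ := isCompact_Icc.exists_bound_of_continuousOn hc
    refine MemLp.of_bound ((hc.mono Set.Ioc_subset_Icc_self).aestronglyMeasurable
      measurableSet_Ioc) C ?_
    filter_upwards [ae_restrict_mem measurableSet_Ioc] with x hx
    exact hC x (Set.Ioc_subset_Icc_self hx)
  refine (h1.sub memLp_log).ae_eq ?_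
  filter_upwards [ae_restrict_mem measurableSet_Ioc] with x hx
  simp only [Pi.sub_apply]
  rw [Real.Gamma_add_one hx.1.ne', Real.log_mul hx.1.ne' (Real.Gamma_pos_of_pos hx.1).ne']
  ring

lemma intervalIntegrable_log_Gamma :
    IntervalIntegrable (fun x => Real.log (Real.Gamma x)) volume 0 1 := by
  rw [intervalIntegrable_iff_integrableOn_Ioc_of_le zero_le_one]
  exact memLp_log_Gamma.integrable one_le_two

lemma integral_log_sin_pi_mul : ∫ x in (0:ℝ)..1, Real.log (Real.sin (π * x)) = -Real.log 2 := by
  have h := intervalIntegral.smul_integral_comp_mul_left (a := 0) (b := 1)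
    (fun x => Real.log (Real.sin x)) π
  rw [mul_zero, mul_one, integral_log_sin_zero_pi, smul_eq_mul, mul_comm] at h
  exact mul_right_cancel₀ Real.pi_ne_zero h

/-- Raabe's formula on the unit interval. -/
lemma integral_log_Gamma :
    ∫ x in (0:ℝ)..1, Real.log (Real.Gamma x) = Real.log (Real.sqrt (2 * π)) := by
  have hr : ∫ x in (0:ℝ)..1, Real.log (Real.Gamma (1 - x)) =
      ∫ x in (0:ℝ)..1, Real.log (Real.Gamma x) := by
    simpa using intervalIntegral.integral_comp_sub_left (a := 0) (b := 1)
      (fun x => Real.log (Real.Gamma x)) 1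
  have hri : IntervalIntegrable (fun x => Real.log (Real.Gamma (1 - x))) volume 0 1 := by
    simpa using (intervalIntegrable_log_Gamma.comp_sub_left 1).symm
  have hsum (x : ℝ) (hx : x ∈ Set.Ioo (0 : ℝ) 1) :
      Real.log (Real.Gamma x) + Real.log (Real.Gamma (1 - x)) =
        Real.log π - Real.log (Real.sin (π * x)) := by
    have hs : 0 < Real.sin (π * x) :=
      Real.sin_pos_of_pos_of_lt_pi (mul_pos Real.pi_pos hx.1) (by nlinarith [hx.2, Real.pi_pos])
    rw [← Real.log_mul (Real.Gamma_pos_of_pos hx.1).ne'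
      (Real.Gamma_pos_of_pos (by linarith [hx.2])).ne', Real.Gamma_mul_Gamma_one_sub,
      Real.log_div Real.pi_ne_zero hs.ne']
  have hsi : IntervalIntegrable (fun x => Real.log (Real.sin (π * x))) volume 0 1 := by
    have h := ((intervalIntegrable_const (c := Real.log π)).sub
      (intervalIntegrable_log_Gamma.add hri))
    refine h.congr_uIoo ?_
    rw [Set.uIoo_of_le zero_le_one]
    intro x hx
    have := hsum x hx
    simp only
    linarith
  have h := intervalIntegral.integral_congr_Ioo_of_le (μ := volume) zero_le_one hsum
  rw [intervalIntegral.integral_add intervalIntegrable_log_Gamma hri, hr,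
    intervalIntegral.integral_sub intervalIntegrable_const hsi, integral_log_sin_pi_mul] at h
  rw [Real.log_sqrt (by positivity), Real.log_mul two_ne_zero Real.pi_ne_zero]
  simp at h
  linarith

lemma two_pi_mul_ne_zero {n : ℕ} (hn : n ≠ 0) : (2 * π * I * n : ℂ) ≠ 0 := by
  simp [hn, Real.pi_ne_zero]

lemma integral_exp_two_pi {n : ℕ} (hn : n ≠ 0) :
    ∫ x in (0:ℝ)..1, cexp (-(2 * π * I * n * x)) = 0 := by
  have hc := two_pi_mul_ne_zero hn
  have h := intervalIntegral.integral_eq_sub_of_hasDerivAt (a := 0) (b := 1)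
    (fun x _ => hasDerivAt_exp_two_pi n x) (Continuous.intervalIntegrable (by fun_prop) _ _)
  have h1 := exp_neg_two_pi_mul_nat n 1
  rw [intervalIntegral.integral_const_mul] at h
  simp only [Nat.cast_one, mul_one] at h1
  simpa [h1, hc] using h

lemma integral_mul_exp_two_pi {n : ℕ} (hn : n ≠ 0) :
    ∫ x in (0:ℝ)..1, (x : ℂ) * cexp (-(2 * π * I * n * x)) = -(1 / (2 * π * I * n)) := by
  have hc := two_pi_mul_ne_zero hn
  have hd (x : ℝ) : HasDerivAt (fun x : ℝ => (x : ℂ) * cexp (-(2 * π * I * n * x)))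
      (cexp (-(2 * π * I * n * x)) - 2 * π * I * n * (x * cexp (-(2 * π * I * n * x)))) x := by
    refine ((Complex.ofRealCLM.hasDerivAt (x := x)).mul
      (hasDerivAt_exp_two_pi n x)).congr_deriv ?_
    simp
    ring
  have h := intervalIntegral.integral_eq_sub_of_hasDerivAt (a := 0) (b := 1)
    (fun x _ => hd x) (Continuous.intervalIntegrable (by fun_prop) _ _)
  have h1 := exp_neg_two_pi_mul_nat n 1
  simp only [Nat.cast_one, mul_one] at h1
  rw [intervalIntegral.integral_sub (Continuous.intervalIntegrable (by fun_prop) _ _)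
    (Continuous.intervalIntegrable (by fun_prop) _ _), integral_exp_two_pi hn,
    intervalIntegral.integral_const_mul] at h
  simp only [Complex.ofReal_one, mul_one, h1, Complex.ofReal_zero, zero_mul, sub_zero] at h
  rw [← neg_div, eq_div_iff hc]
  linear_combination -h

lemma intervalIntegrable_log_add_mul_exp (n k : ℕ) :
    IntervalIntegrable (fun x : ℝ => (Real.log (x + k) : ℂ) * cexp (-(2 * π * I * n * x)))
      volume 0 1 := by
  have h : IntervalIntegrable (fun x : ℝ => Real.log (x + k)) volume 0 1 := by
    have := (intervalIntegral.intervalIntegrable_log' (a := k) (b := k + 1)).comp_add_right (k : ℝ)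
    simpa using this
  exact h.complex_ofReal.mul_continuousOn (by fun_prop)

lemma intervalIntegrable_sum_log_add_mul_exp (n m : ℕ) :
    IntervalIntegrable (fun x : ℝ => ∑ k ∈ Finset.range m,
      (Real.log (x + k) : ℂ) * cexp (-(2 * π * I * n * x))) volume 0 1 := by
  simpa only [Finset.sum_fn] using
    IntervalIntegrable.sum (Finset.range m) fun k _ => intervalIntegrable_log_add_mul_exp n k

lemma sum_integral_log_add_mul_exp (n m : ℕ) :
    ∑ k ∈ Finset.range m,
      ∫ x in (0:ℝ)..1, (Real.log (x + k) : ℂ) * cexp (-(2 * π * I * n * x)) =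
    ∫ x in (0:ℝ)..m, (Real.log x : ℂ) * cexp (-(2 * π * I * n * x)) := by
  have hi (a b : ℝ) : IntervalIntegrable
      (fun x : ℝ => (Real.log x : ℂ) * cexp (-(2 * π * I * n * x))) volume a b :=
    intervalIntegral.intervalIntegrable_log'.complex_ofReal.mul_continuousOn (by fun_prop)
  have h := intervalIntegral.sum_integral_adjacent_intervals (a := fun k : ℕ => (k : ℝ)) (n := m)
    (fun k _ => hi k (k + 1 : ℕ))
  rw [Nat.cast_zero] at h
  rw [← h]
  refine Finset.sum_congr rfl fun k _ => ?_
  have hs := intervalIntegral.integral_comp_add_right (a := 0) (b := 1)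
    (fun x : ℝ => (Real.log x : ℂ) * cexp (-(2 * π * I * n * x))) (k : ℝ)
  rw [zero_add, add_comm (1 : ℝ)] at hs
  rw [Nat.cast_add, Nat.cast_one, ← hs]
  refine intervalIntegral.integral_congr fun x _ => ?_
  have he : cexp (-(2 * π * I * n * (x + k : ℝ))) = cexp (-(2 * π * I * n * x)) := by
    rw [← mul_one (cexp (-(2 * π * I * n * x))), ← exp_neg_two_pi_mul_nat n k, ← Complex.exp_add]
    congr 1
    push_cast
    ring
  simp only [he]

lemma logGammaSeq_mul_exp (n m : ℕ) (x : ℝ) :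
    (BohrMollerup.logGammaSeq x m : ℂ) * cexp (-(2 * π * I * n * x)) =
      Real.log m * (x * cexp (-(2 * π * I * n * x))) +
        Real.log m.factorial * cexp (-(2 * π * I * n * x)) -
      ∑ k ∈ Finset.range (m + 1), (Real.log (x + k) : ℂ) * cexp (-(2 * π * I * n * x)) := by
  rw [BohrMollerup.logGammaSeq, ← Finset.sum_mul]
  push_cast
  ring

lemma intervalIntegrable_logGammaSeq_mul_exp (n m : ℕ) :
    IntervalIntegrable (fun x : ℝ => (BohrMollerup.logGammaSeq x m : ℂ) *
      cexp (-(2 * π * I * n * x))) volume 0 1 := by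
  simp_rw [logGammaSeq_mul_exp]
  exact (Continuous.intervalIntegrable (by fun_prop) _ _).sub
    (intervalIntegrable_sum_log_add_mul_exp n (m + 1))

lemma integral_logGammaSeq_mul_exp {n : ℕ} (hn : n ≠ 0) (m : ℕ) :
    ∫ x in (0:ℝ)..1, (BohrMollerup.logGammaSeq x m : ℂ) * cexp (-(2 * π * I * n * x)) =
      1 / (2 * π * I * n) * ((∫ x in (0:ℝ)..1,
        (1 - cexp (-(2 * π * I * (n * (m + 1) : ℕ) * x))) / x) - Real.log m) := by
  simp_rw [logGammaSeq_mul_exp]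
  rw [intervalIntegral.integral_sub (Continuous.intervalIntegrable (by fun_prop) _ _)
    (intervalIntegrable_sum_log_add_mul_exp n (m + 1)),
    intervalIntegral.integral_finsetSum fun k _ => intervalIntegrable_log_add_mul_exp n k,
    sum_integral_log_add_mul_exp, integral_log_mul_exp hn (Nat.succ_ne_zero m),
    intervalIntegral.integral_add (Continuous.intervalIntegrable (by fun_prop) _ _)
    (Continuous.intervalIntegrable (by fun_prop) _ _),
    intervalIntegral.integral_const_mul, intervalIntegral.integral_const_mul,
    integral_exp_two_pi hn, integral_mul_exp_two_pi hn]
  ring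

/-- The Fourier coefficients of `log Γ` on the unit interval. -/
lemma integral_log_Gamma_mul_exp {n : ℕ} (hn : n ≠ 0) :
    ∫ x in (0:ℝ)..1, (Real.log (Real.Gamma x) : ℂ) * cexp (-(2 * π * I * n * x)) =
      1 / (2 * π * I * n) *
        (Real.log (2 * π * n) + Real.eulerMascheroniConstant + I * π / 2) := by
  have hlim1 : Tendsto (fun m : ℕ => ∫ x in (0:ℝ)..1, (BohrMollerup.logGammaSeq x m : ℂ) *
      cexp (-(2 * π * I * n * x))) atTop
      (𝓝 (∫ x in (0:ℝ)..1, (Real.log (Real.Gamma x) : ℂ) * cexp (-(2 * π * I * n * x)))) := by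
    rw [← tendsto_sub_nhds_zero_iff]
    refine squeeze_zero_norm' ?_ Real.tendsto_log_nat_add_one_sub_log
    filter_upwards [eventually_ne_atTop 0] with m hm
    rw [← intervalIntegral.integral_sub (intervalIntegrable_logGammaSeq_mul_exp n m)
      (intervalIntegrable_log_Gamma.complex_ofReal.mul_continuousOn (by fun_prop))]
    have h := intervalIntegral.norm_integral_le_of_norm_le_const (a := 0) (b := 1)
      (C := Real.log (m + 1) - Real.log m)
      (f := fun x : ℝ => (BohrMollerup.logGammaSeq x m : ℂ) * cexp (-(2 * π * I * n * x)) -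
        (Real.log (Real.Gamma x) : ℂ) * cexp (-(2 * π * I * n * x))) ?_
    · simpa using h
    · intro x hx
      rw [Set.uIoc_of_le zero_le_one] at hx
      have he : ‖cexp (-(2 * π * I * n * x))‖ = 1 := by
        have : -(2 * π * I * n * x : ℂ) = ((-(2 * π * n * x) : ℝ) : ℂ) * I := by push_cast; ring
        rw [this, Complex.norm_exp_ofReal_mul_I]
      rw [← sub_mul, norm_mul, he, mul_one, ← Complex.ofReal_sub, Complex.norm_real,
        Real.norm_eq_abs, abs_sub_comm]
      exact abs_log_Gamma_sub_logGammaSeq_le hx hm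
  have hn0 : (n : ℝ) ≠ 0 := by exact_mod_cast hn
  have hlim2 : Tendsto (fun m : ℕ => ∫ x in (0:ℝ)..1, (BohrMollerup.logGammaSeq x m : ℂ) *
      cexp (-(2 * π * I * n * x))) atTop (𝓝 (1 / (2 * π * I * n) *
        (Real.log (2 * π * n) + Real.eulerMascheroniConstant + I * π / 2))) := by
    have hsub : Tendsto (fun m : ℕ => n * (m + 1)) atTop atTop :=
      (tendsto_add_atTop_nat 1).const_mul_atTop' (Nat.pos_of_ne_zero hn)
    have h := (((tendsto_integral_one_sub_exp_div.comp hsub).add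
      ((Complex.continuous_ofReal.tendsto _).comp Real.tendsto_log_nat_add_one_sub_log)).add_const
      (Real.log n : ℂ)).const_mul (1 / (2 * π * I * n : ℂ))
    rw [Real.log_mul (by positivity) hn0]
    convert h using 2 with m
    · rw [integral_logGammaSeq_mul_exp hn m]
      have hm1 : (m + 1 : ℝ) ≠ 0 := by positivity
      simp only [Function.comp_apply]
      rw [Nat.cast_mul n (m + 1), Nat.cast_mul n (m + 1), Nat.cast_add, Nat.cast_add, Nat.cast_one,
        Nat.cast_one, Real.log_mul hn0 hm1]
      push_cast
      ring
    · push_cast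
      ring
  exact tendsto_nhds_unique hlim1 hlim2

lemma norm_sq_integral_log_Gamma_mul_exp {n : ℕ} (hn : n ≠ 0) :
    ‖∫ x in (0:ℝ)..1, (Real.log (Real.Gamma x) : ℂ) * cexp (-(2 * π * I * n * x))‖ ^ 2 =
      1 / (4 * n ^ 2) * ((Real.log (2 * π * n) + Real.eulerMascheroniConstant) ^ 2 / π ^ 2
        + 1 / 4) := by
  have hn0 : (n : ℝ) ≠ 0 := by exact_mod_cast hn
  have e : (Real.log (2 * π * n) + Real.eulerMascheroniConstant + I * π / 2 : ℂ) =
      ((Real.log (2 * π * n) + Real.eulerMascheroniConstant : ℝ) : ℂ) + ((π / 2 : ℝ) : ℂ) * I := by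
    push_cast
    ring
  rw [integral_log_Gamma_mul_exp hn, norm_mul, mul_pow, e, ← Complex.normSq_eq_norm_sq (_ + _),
    Complex.normSq_add_mul_I]
  simp [abs_of_pos Real.pi_pos]
  field_simp
  ring

/-- The function whose Fourier coefficients Kummer's series records. -/
noncomputable def kummerFunction (x : ℝ) : ℝ :=
  Real.log (Real.Gamma x / Real.sqrt (2 * π))

lemma kummerFunction_eq {x : ℝ} (hx : 0 < x) :
    kummerFunction x = Real.log (Real.Gamma x) - Real.log (Real.sqrt (2 * π)) := by
  have := Real.pi_pos
  rw [kummerFunction, Real.log_div (Real.Gamma_pos_of_pos hx).ne' (by positivity)]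

lemma memLp_kummerFunction :
    MemLp (fun x => (kummerFunction x : ℂ)) 2 (volume.restrict (Set.Ioc (0 : ℝ) 1)) := by
  refine MemLp.ofReal (f := kummerFunction) ?_
  refine (memLp_log_Gamma.sub (memLp_const (Real.log (Real.sqrt (2 * π))))).ae_eq ?_
  filter_upwards [ae_restrict_mem measurableSet_Ioc] with x hx
  simp only [Pi.sub_apply, kummerFunction_eq hx.1]

lemma fourierCoeffOn_kummerFunction (n : ℤ) :
    fourierCoeffOn zero_lt_one (fun x => (kummerFunction x : ℂ)) n =
      (∫ x in (0:ℝ)..1, (Real.log (Real.Gamma x) : ℂ) * cexp (-(2 * π * I * n * x))) -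
        Real.log (Real.sqrt (2 * π)) * ∫ x in (0:ℝ)..1, cexp (-(2 * π * I * n * x)) := by
  rw [fourierCoeffOn_eq_integral, ← intervalIntegral.integral_const_mul,
    ← intervalIntegral.integral_sub
      (intervalIntegrable_log_Gamma.complex_ofReal.mul_continuousOn (by fun_prop))
      (Continuous.intervalIntegrable (by fun_prop) _ _)]
  simp only [sub_zero, div_one, one_smul]
  refine intervalIntegral.integral_congr_Ioo_of_le zero_le_one fun x hx => ?_
  simp only [kummerFunction_eq hx.1, smul_eq_mul]
  have he : (fourier (-n) (x : AddCircle (1 - 0 : ℝ)) : ℂ) = cexp (-(2 * π * I * n * x)) := by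
    rw [fourier_coe_apply]
    congr 1
    push_cast
    ring
  rw [he]
  push_cast
  ring

lemma fourierCoeffOn_kummerFunction_zero :
    fourierCoeffOn zero_lt_one (fun x => (kummerFunction x : ℂ)) 0 = 0 := by
  rw [fourierCoeffOn_kummerFunction]
  simp [intervalIntegral.integral_ofReal, integral_log_Gamma]

lemma fourierCoeffOn_kummerFunction_natCast {n : ℕ} (hn : n ≠ 0) :
    fourierCoeffOn zero_lt_one (fun x => (kummerFunction x : ℂ)) n =
      ∫ x in (0:ℝ)..1, (Real.log (Real.Gamma x) : ℂ) * cexp (-(2 * π * I * n * x)) := by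
  rw [fourierCoeffOn_kummerFunction]
  simp only [Int.cast_natCast]
  rw [integral_exp_two_pi hn]
  simp

lemma norm_fourierCoeffOn_neg {f : ℝ → ℝ} {a b : ℝ} (hab : a < b) (n : ℤ) :
    ‖fourierCoeffOn hab (fun x => (f x : ℂ)) (-n)‖ =
      ‖fourierCoeffOn hab (fun x => (f x : ℂ)) n‖ := by
  rw [fourierCoeffOn_eq_integral, fourierCoeffOn_eq_integral, norm_smul, norm_smul,
    ← Complex.norm_conj (∫ x in a..b, fourier (-n) (x : AddCircle (b - a)) • (f x : ℂ)),
    ← intervalIntegral.intervalIntegral_conj]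
  simp only [smul_eq_mul, map_mul, Complex.conj_ofReal, ← fourier_neg]

theorem kummer_parseval :
    ∫ α in (0:ℝ)..1, (Real.log (Real.Gamma α / Real.sqrt (2 * π))) ^ 2
      = ∑' n : ℕ, (1 / (2 * ((n : ℝ) + 1) ^ 2)) *
          ((Real.log (2 * π * ((n : ℝ) + 1)) + Real.eulerMascheroniConstant) ^ 2 / π ^ 2
            + 1 / 4) := by
  have h := hasSum_sq_fourierCoeffOn zero_lt_one memLp_kummerFunction
  have hsucc := ((hasSum_nat_add_iff' 1).2 h.nat_add_neg).tsum_eq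
  simp only [Finset.range_one, Finset.sum_singleton, Nat.cast_zero, neg_zero,
    fourierCoeffOn_kummerFunction_zero] at hsucc
  simp only [norm_zero, ne_eq, OfNat.ofNat_ne_zero, not_false_eq_true, zero_pow, add_zero,
    sub_zero, inv_one, one_smul, Complex.norm_real, Real.norm_eq_abs, sq_abs] at hsucc
  change ∫ α in (0:ℝ)..1, kummerFunction α ^ 2 = _
  rw [← hsucc]
  refine tsum_congr fun n => ?_
  have hn := norm_sq_integral_log_Gamma_mul_exp (Nat.succ_ne_zero n)
  rw [← fourierCoeffOn_kummerFunction_natCast (Nat.succ_ne_zero n), Nat.succ_eq_add_one] at hn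
  rw [norm_fourierCoeffOn_neg, hn]
  push_cast
  field_simp
  ring
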